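/- arXiv:2111.11556 — 4 statements merged into one kernel-verified Lean document; each statement's English description precedes it below -/
import Mathlib

section
/- Let f₁,…,fₙ : ℝ^d → ℝ be differentiable, α₁,…,αₙ ∈ ℝ, and x₁,…,xₙ ∈ ℝ^d, and define the FLIX objective f̃(x) = (1/n)∑_{i=1}^n f_i(α_i x + (1−α_i)x_i). (i) If each f_i is L_i-smooth, then f̃ is L_α-smooth with L_α = (1/n)∑_{i=1}^n α_i² L_i. (ii) If each f_i is convex, then f̃ is convex. (iii) If each f_i is μ_i-strongly convex, then f̃ is μ_α-strongly convex with μ_α = (1/n)∑_{i=1}^n α_i² μ_i. -/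
open scoped RealInnerProductSpace

/-- `g` is `L`-smooth: its gradient is `L`-Lipschitz. -/
def LSmooth {d : ℕ} (L : ℝ) (g : EuclideanSpace ℝ (Fin d) → ℝ) : Prop :=
  ∀ x y, ‖gradient g x - gradient g y‖ ≤ L * ‖x - y‖

/-- `g` is `μ`-strongly convex (convexity corresponds to `μ = 0`). -/
def StrongConvexWith {d : ℕ} (μ : ℝ) (g : EuclideanSpace ℝ (Fin d) → ℝ) : Prop :=
  ∀ x y, g y + ⟪gradient g y, x - y⟫ + μ / 2 * ‖x - y‖ ^ 2 ≤ g x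

theorem HasGradientAt.comp_smul_add {E : Type*} [NormedAddCommGroup E] [InnerProductSpace ℝ E]
    [CompleteSpace E] {f : E → ℝ} {g : E} {a : ℝ} {c x : E}
    (hf : HasGradientAt f g (a • x + c)) :
    HasGradientAt (fun y => f (a • y + c)) (a • g) x := by
  rw [hasGradientAt_iff_hasFDerivAt] at hf ⊢
  have hinner : HasFDerivAt (fun y : E => a • y + c) (a • ContinuousLinearMap.id ℝ E) x :=
    ((hasFDerivAt_id x).const_smul a).add_const c
  refine (hf.comp x hinner).congr_fderiv ?_
  ext v
  simp

theorem HasGradientAt.const_mul_sum {E ι : Type*} [NormedAddCommGroup E] [InnerProductSpace ℝ E]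
    [CompleteSpace E] (s : Finset ι) {f : ι → E → ℝ} {g : ι → E} {x : E}
    (hf : ∀ i ∈ s, HasGradientAt (f i) (g i) x) (c : ℝ) :
    HasGradientAt (fun y => c * ∑ i ∈ s, f i y) (c • ∑ i ∈ s, g i) x := by
  simp only [hasGradientAt_iff_hasFDerivAt] at hf ⊢
  simpa using (HasFDerivAt.fun_sum hf).const_mul c

section Smoothness

variable {d : ℕ} {f : EuclideanSpace ℝ (Fin d) → ℝ}

theorem LSmooth.comp_smul_add {L : ℝ} (hL : LSmooth L f) (hf : Differentiable ℝ f) (a : ℝ)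
    (c : EuclideanSpace ℝ (Fin d)) : LSmooth (a ^ 2 * L) fun x => f (a • x + c) := by
  intro x y
  rw [(hf _).hasGradientAt.comp_smul_add.gradient, (hf _).hasGradientAt.comp_smul_add.gradient,
    ← smul_sub, norm_smul, Real.norm_eq_abs]
  calc |a| * ‖gradient f (a • x + c) - gradient f (a • y + c)‖
      ≤ |a| * (L * ‖(a • x + c) - (a • y + c)‖) := by gcongr; exact hL _ _
    _ = a ^ 2 * L * ‖x - y‖ := by
      rw [add_sub_add_right_eq_sub, ← smul_sub, norm_smul, Real.norm_eq_abs, ← sq_abs a]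
      ring

theorem StrongConvexWith.comp_smul_add {μ : ℝ} (hμ : StrongConvexWith μ f)
    (hf : Differentiable ℝ f) (a : ℝ) (c : EuclideanSpace ℝ (Fin d)) :
    StrongConvexWith (a ^ 2 * μ) fun x => f (a • x + c) := by
  intro x y
  have h := hμ (a • x + c) (a • y + c)
  rw [add_sub_add_right_eq_sub, ← smul_sub, norm_smul, Real.norm_eq_abs, mul_pow, sq_abs,
    real_inner_smul_right] at h
  rw [(hf _).hasGradientAt.comp_smul_add.gradient, real_inner_smul_left]
  linarith

variable {ι : Type*} (s : Finset ι) {F : ι → EuclideanSpace ℝ (Fin d) → ℝ}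

theorem LSmooth.const_mul_sum {L : ι → ℝ} (hL : ∀ i ∈ s, LSmooth (L i) (F i))
    (hF : ∀ i ∈ s, Differentiable ℝ (F i)) {c : ℝ} (hc : 0 ≤ c) :
    LSmooth (c * ∑ i ∈ s, L i) fun x => c * ∑ i ∈ s, F i x := by
  intro x y
  have hgrad (z) := (HasGradientAt.const_mul_sum s
    (fun i hi => (hF i hi z).hasGradientAt) c).gradient
  rw [hgrad, hgrad, ← smul_sub, ← Finset.sum_sub_distrib, norm_smul, Real.norm_of_nonneg hc,
    mul_assoc, Finset.sum_mul]
  exact mul_le_mul_of_nonneg_left (norm_sum_le_of_le s fun i hi => hL i hi x y) hc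

theorem StrongConvexWith.const_mul_sum {μ : ι → ℝ} (hμ : ∀ i ∈ s, StrongConvexWith (μ i) (F i))
    (hF : ∀ i ∈ s, Differentiable ℝ (F i)) {c : ℝ} (hc : 0 ≤ c) :
    StrongConvexWith (c * ∑ i ∈ s, μ i) fun x => c * ∑ i ∈ s, F i x := by
  intro x y
  beta_reduce
  rw [(HasGradientAt.const_mul_sum s (fun i hi => (hF i hi y).hasGradientAt) c).gradient,
    real_inner_smul_left, sum_inner, mul_div_assoc, mul_assoc, ← mul_add, ← mul_add,
    Finset.sum_div, Finset.sum_mul, ← Finset.sum_add_distrib, ← Finset.sum_add_distrib]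
  gcongr with i hi
  exact hμ i hi x y

end Smoothness

/-- the FLIX objective preserves smoothness, convexity and strong convexity. -/
theorem flix_preserves_smoothness_and_convexity {d n : ℕ} (hn : 0 < n)
    (f : Fin n → EuclideanSpace ℝ (Fin d) → ℝ)
    (hdiff : ∀ i, Differentiable ℝ (f i))
    (α L μ : Fin n → ℝ) (xs : Fin n → EuclideanSpace ℝ (Fin d))
    (ftilde : EuclideanSpace ℝ (Fin d) → ℝ)
    (hft : ftilde = fun x => (1 / n : ℝ) * ∑ i, f i (α i • x + (1 - α i) • xs i)) :
    ((∀ i, LSmooth (L i) (f i)) →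
        LSmooth ((1 / n : ℝ) * ∑ i, α i ^ 2 * L i) ftilde)
    ∧ ((∀ i, StrongConvexWith 0 (f i)) → StrongConvexWith 0 ftilde)
    ∧ ((∀ i, StrongConvexWith (μ i) (f i)) →
        StrongConvexWith ((1 / n : ℝ) * ∑ i, α i ^ 2 * μ i) ftilde) := by
  subst hft
  have hn' : (0 : ℝ) ≤ 1 / n := by positivity
  have hcomp (i : Fin n) : Differentiable ℝ fun x => f i (α i • x + (1 - α i) • xs i) :=
    (hdiff i).comp ((differentiable_id.const_smul (α i)).add_const _)
  have hstrong (ν : Fin n → ℝ) (h : ∀ i, StrongConvexWith (ν i) (f i)) :=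
    StrongConvexWith.const_mul_sum Finset.univ
      (fun i _ => (h i).comp_smul_add (hdiff i) (α i) ((1 - α i) • xs i))
      (fun i _ => hcomp i) hn'
  refine ⟨fun h => ?_, fun h => ?_, hstrong μ⟩
  · exact LSmooth.const_mul_sum Finset.univ
      (fun i _ => (h i).comp_smul_add (hdiff i) (α i) ((1 - α i) • xs i))
      (fun i _ => hcomp i) hn'
  · simpa using hstrong 0 h
end

section
/- Let f₁,…,fₙ : ℝ^d → ℝ be differentiable with each f_i L_i-smooth, let α₁,…,αₙ ∈ ℝ, let x_i be a global minimizer of f_i for each i (so ∇f_i(x_i) = 0), and define f̃(x) = (1/n)∑_{i=1}^n f_i(α_i x + (1−α_i)x_i). Then for every x ∈ ℝ^d: (i) ‖∇f̃(x)‖ ≤ (1/n)∑_{i=1}^n α_i² L_i ‖x − x_i‖, and (ii) f̃(x) ≤ (1/n)∑_{i=1}^n f_i(x_i) + (1/(2n))∑_{i=1}^n α_i² L_i ‖x − x_i‖². -/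
open scoped RealInnerProductSpace

theorem gradient_eq_zero_of_forall_le {F : Type*} [NormedAddCommGroup F] [InnerProductSpace ℝ F]
    [CompleteSpace F] {g : F → ℝ} {z : F} (hz : ∀ y, g z ≤ g y) : gradient g z = 0 := by
  have hmin : IsLocalMin g z := Filter.Eventually.of_forall hz
  simp [gradient, hmin.fderiv_eq_zero]

theorem HasGradientAt.comp_smul_add_const {F : Type*} [NormedAddCommGroup F]
    [InnerProductSpace ℝ F] [CompleteSpace F] {g : F → ℝ} {g' x c : F} {a : ℝ}
    (hg : HasGradientAt g g' (a • x + c)) :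
    HasGradientAt (fun y => g (a • y + c)) (a • g') x := by
  have hinner : HasFDerivAt (fun y : F => a • y + c) (a • ContinuousLinearMap.id ℝ F) x :=
    ((hasFDerivAt_id x).const_smul a).add_const c
  rw [hasGradientAt_iff_hasFDerivAt] at hg ⊢
  refine (hg.comp x hinner).congr_fderiv ?_
  ext y
  simp

/-- The gradient of a smooth function at a point is controlled by the distance to a minimizer. -/
theorem LSmooth.norm_gradient_le {d : ℕ} {L : ℝ} {g : EuclideanSpace ℝ (Fin d) → ℝ}
    (hL : LSmooth L g) {z : EuclideanSpace ℝ (Fin d)} (hz : ∀ y, g z ≤ g y)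
    (w : EuclideanSpace ℝ (Fin d)) : ‖gradient g w‖ ≤ L * ‖w - z‖ := by
  simpa [gradient_eq_zero_of_forall_le hz] using hL w z

/-- The descent lemma at a minimizer. -/
theorem LSmooth.le_add_sq {d : ℕ} {L : ℝ} {g : EuclideanSpace ℝ (Fin d) → ℝ}
    (hL : LSmooth L g) (hg : Differentiable ℝ g) {z : EuclideanSpace ℝ (Fin d)}
    (hz : ∀ y, g z ≤ g y) (v : EuclideanSpace ℝ (Fin d)) :
    g (z + v) ≤ g z + L / 2 * ‖v‖ ^ 2 := by
  have hline (t : ℝ) : HasDerivAt (fun s : ℝ => g (z + s • v)) ⟪gradient g (z + t • v), v⟫ t := by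
    have hinner : HasDerivAt (fun s : ℝ => z + s • v) v t := by
      simpa using ((hasDerivAt_id t).smul_const v).const_add z
    rw [inner_gradient_left]
    exact (hg (z + t • v)).hasFDerivAt.comp_hasDerivAt t hinner
  have hquad (t : ℝ) : HasDerivAt (fun s : ℝ => g z + L / 2 * ‖v‖ ^ 2 * s ^ 2)
      (L * ‖v‖ ^ 2 * t) t := by
    refine (((hasDerivAt_pow 2 t).const_mul (L / 2 * ‖v‖ ^ 2)).const_add (g z)).congr_deriv ?_
    norm_num
    ring
  have hbound : ∀ t ∈ Set.Ico (0 : ℝ) 1, ⟪gradient g (z + t • v), v⟫ ≤ L * ‖v‖ ^ 2 * t := by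
    intro t ht
    calc ⟪gradient g (z + t • v), v⟫ ≤ ‖gradient g (z + t • v)‖ * ‖v‖ := real_inner_le_norm _ _
      _ ≤ L * ‖z + t • v - z‖ * ‖v‖ := by gcongr; exact hL.norm_gradient_le hz _
      _ = L * ‖v‖ ^ 2 * t := by
        rw [add_sub_cancel_left, norm_smul, Real.norm_of_nonneg ht.1]
        ring
  have hle := image_le_of_deriv_right_le_deriv_boundary
    (fun t _ => (hline t).continuousAt.continuousWithinAt)
    (fun t _ => (hline t).hasDerivWithinAt) (by simp)
    (fun t _ => (hquad t).continuousAt.continuousWithinAt)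
    (fun t _ => (hquad t).hasDerivWithinAt) hbound (Set.right_mem_Icc.mpr zero_le_one)
  simpa using hle

/-- bounds on the gradient norm and value of the FLIX objective
in terms of weighted averages of distances to the local minimizers. -/
theorem flix_bounds_local_average {d n : ℕ} (hn : 0 < n)
    (f : Fin n → EuclideanSpace ℝ (Fin d) → ℝ)
    (hdiff : ∀ i, Differentiable ℝ (f i))
    (L : Fin n → ℝ) (hsmooth : ∀ i, LSmooth (L i) (f i))
    (α : Fin n → ℝ) (xs : Fin n → EuclideanSpace ℝ (Fin d))
    (hxs : ∀ i y, f i (xs i) ≤ f i y)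
    (ftilde : EuclideanSpace ℝ (Fin d) → ℝ)
    (hft : ftilde = fun x => (1 / n : ℝ) * ∑ i, f i (α i • x + (1 - α i) • xs i))
    (x : EuclideanSpace ℝ (Fin d)) :
    ‖gradient ftilde x‖ ≤ (1 / n : ℝ) * ∑ i, α i ^ 2 * L i * ‖x - xs i‖
      ∧ ftilde x ≤ (1 / n : ℝ) * ∑ i, f i (xs i)
          + (1 / (2 * n) : ℝ) * ∑ i, α i ^ 2 * L i * ‖x - xs i‖ ^ 2 := by
  subst hft
  have hsub (i : Fin n) : α i • x + (1 - α i) • xs i - xs i = α i • (x - xs i) := by module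
  constructor
  · have hgrad : HasGradientAt
        (fun y => (1 / n : ℝ) * ∑ i, f i (α i • y + (1 - α i) • xs i))
        ((1 / n : ℝ) • ∑ i, α i • gradient (f i) (α i • x + (1 - α i) • xs i)) x := by
      have hterm (i : Fin n) :=
        ((hdiff i (α i • x + (1 - α i) • xs i)).hasGradientAt.comp_smul_add_const).hasFDerivAt
      rw [hasGradientAt_iff_hasFDerivAt]
      refine ((HasFDerivAt.fun_sum fun i _ => hterm i).const_mul (1 / n : ℝ)).congr_fderiv ?_
      simp
    rw [hgrad.gradient, norm_smul, Real.norm_of_nonneg (by positivity)]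
    gcongr
    refine norm_sum_le_of_le _ fun i _ => ?_
    calc ‖α i • gradient (f i) (α i • x + (1 - α i) • xs i)‖
        = |α i| * ‖gradient (f i) (α i • x + (1 - α i) • xs i)‖ := by
          rw [norm_smul, Real.norm_eq_abs]
      _ ≤ |α i| * (L i * ‖α i • x + (1 - α i) • xs i - xs i‖) := by
          gcongr
          exact (hsmooth i).norm_gradient_le (hxs i) _
      _ = α i ^ 2 * L i * ‖x - xs i‖ := by
          rw [hsub, norm_smul, Real.norm_eq_abs, ← sq_abs (α i)]
          ring
  · have hterm (i : Fin n) : f i (α i • x + (1 - α i) • xs i) ≤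
        f i (xs i) + 1 / 2 * (α i ^ 2 * L i * ‖x - xs i‖ ^ 2) := by
      calc f i (α i • x + (1 - α i) • xs i) = f i (xs i + α i • (x - xs i)) := by
            rw [← hsub, add_sub_cancel]
        _ ≤ f i (xs i) + L i / 2 * ‖α i • (x - xs i)‖ ^ 2 :=
            (hsmooth i).le_add_sq (hdiff i) (hxs i) _
        _ = f i (xs i) + 1 / 2 * (α i ^ 2 * L i * ‖x - xs i‖ ^ 2) := by
            rw [norm_smul, mul_pow, Real.norm_eq_abs, sq_abs]
            ring
    calc (1 / n : ℝ) * ∑ i, f i (α i • x + (1 - α i) • xs i)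
        ≤ (1 / n : ℝ) * ∑ i, (f i (xs i) + 1 / 2 * (α i ^ 2 * L i * ‖x - xs i‖ ^ 2)) := by
          gcongr with i
          exact hterm i
      _ = _ := by
          rw [Finset.sum_add_distrib, ← Finset.mul_sum]
          ring
end

section
/- Let f₁,…,fₙ : ℝ^d → ℝ be differentiable with each f_i L_i-smooth, let α₁,…,αₙ ≥ 0, let x_i be a global minimizer of f_i for each i, define f̃(x) = (1/n)∑_{i=1}^n f_i(α_i x + (1−α_i)x_i), L̂ = (1/n)∑_{i=1}^n L_i, L_α = (1/n)∑_{i=1}^n α_i² L_i (assume L_α > 0), w_i = α_i² L_i/(n L_α), x^avg = ∑_{i=1}^n w_i x_i, D = max_{i≠j} ‖x_i − x_j‖², and V = ∑_{i=1}^n w_i ‖x_i − x^avg‖². Fix ε > 0 and suppose either (a) max_i α_i ≤ √(2ε/(L̂ D)), or (b) α_i = β for all i and β ≤ √(2ε/(L̂ V)). Then x^avg is an ε-approximate minimizer of f̃, i.e. f̃(x^avg) − inf_{x∈ℝ^d} f̃(x) ≤ ε. -/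
open scoped RealInnerProductSpace

/-- A differentiable function whose gradient is `L`-Lipschitz exceeds its minimum
`g y` by at most `L / 2 * ‖v‖ ^ 2` at the point `y + v`. -/
theorem LSmooth.sub_le_of_forall_le {d : ℕ} {L : ℝ} {g : EuclideanSpace ℝ (Fin d) → ℝ}
    (hg : LSmooth L g) (hdiff : Differentiable ℝ g) {y : EuclideanSpace ℝ (Fin d)}
    (hy : ∀ z, g y ≤ g z) (v : EuclideanSpace ℝ (Fin d)) :
    g (y + v) ≤ g y + L / 2 * ‖v‖ ^ 2 := by
  have hgrad : gradient g y = 0 := by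
    have hmin : IsLocalMin g y := Filter.Eventually.of_forall hy
    simp [gradient, hmin.fderiv_eq_zero]
  have hderiv (t : ℝ) : HasDerivAt (fun t : ℝ => g (y + t • v) - L / 2 * ‖v‖ ^ 2 * t ^ 2)
      (⟪gradient g (y + t • v), v⟫ - L * ‖v‖ ^ 2 * t) t := by
    have hline : HasDerivAt (fun t : ℝ => y + t • v) v t := by
      simpa using ((hasDerivAt_id t).smul_const v).const_add y
    have hcomp := (hdiff (y + t • v)).hasGradientAt.hasFDerivAt.comp_hasDerivAt t hline
    have hsq := ((hasDerivAt_id t).pow 2).const_mul (L / 2 * ‖v‖ ^ 2)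
    refine (hcomp.sub hsq).congr_deriv ?_
    simp
    ring
  have hanti : AntitoneOn (fun t : ℝ => g (y + t • v) - L / 2 * ‖v‖ ^ 2 * t ^ 2)
      (Set.Icc 0 1) := by
    refine antitoneOn_of_deriv_nonpos (convex_Icc 0 1)
      (fun t _ => (hderiv t).continuousAt.continuousWithinAt)
      (fun t _ => (hderiv t).differentiableAt.differentiableWithinAt) fun t ht => ?_
    rw [interior_Icc] at ht
    rw [(hderiv t).deriv]
    have hlip : ‖gradient g (y + t • v)‖ ≤ L * (t * ‖v‖) := by
      simpa [hgrad, norm_smul, abs_of_pos ht.1] using hg (y + t • v) y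
    have hinner := real_inner_le_norm (gradient g (y + t • v)) v
    have := mul_le_mul_of_nonneg_right hlip (norm_nonneg v)
    nlinarith
  have h01 := hanti (Set.left_mem_Icc.2 zero_le_one) (Set.right_mem_Icc.2 zero_le_one) zero_le_one
  simp only [one_smul, zero_smul, add_zero] at h01
  linarith

/-- In positive dimension a smoothness constant is nonnegative. -/
theorem LSmooth.nonneg {d : ℕ} [Nontrivial (EuclideanSpace ℝ (Fin d))] {L : ℝ}
    {g : EuclideanSpace ℝ (Fin d) → ℝ} (hg : LSmooth L g) : 0 ≤ L := by
  obtain ⟨x, y, hxy⟩ := exists_pair_ne (EuclideanSpace ℝ (Fin d))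
  exact nonneg_of_mul_nonneg_left ((norm_nonneg _).trans (hg x y))
    (norm_pos_iff.2 (sub_ne_zero.2 hxy))

/-- If a nonnegative `a` is at most `√(c / b)`, then `a ^ 2 * b ≤ c`, even when `b = 0`. -/
theorem Real.sq_mul_le_of_le_sqrt_div {a b c : ℝ} (ha : 0 ≤ a) (hb : 0 ≤ b) (hc : 0 ≤ c)
    (h : a ≤ Real.sqrt (c / b)) : a ^ 2 * b ≤ c := by
  have hsq : a ^ 2 ≤ c / b := (Real.le_sqrt ha (by positivity)).1 h
  rcases hb.eq_or_lt with rfl | hb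
  · simpa using hc
  · rwa [le_div_iff₀ hb] at hsq

/-- The squared distance to a convex combination is at most any common bound on the squared
distances to the combined points. -/
theorem norm_sub_sum_smul_sq_le {ι E : Type*} [Fintype ι] [SeminormedAddCommGroup E]
    [NormedSpace ℝ E] {w : ι → ℝ} (hw : ∀ i, 0 ≤ w i) (hsum : ∑ i, w i = 1) {x : ι → E} {y : E}
    {D : ℝ} (hD : ∀ i, ‖y - x i‖ ^ 2 ≤ D) : ‖y - ∑ i, w i • x i‖ ^ 2 ≤ D := by
  have hmem : ∑ i, w i • x i ∈ Metric.closedBall y (Real.sqrt D) :=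
    (convex_closedBall y _).sum_mem (fun i _ => hw i) hsum fun i _ => by
      rw [Metric.mem_closedBall, dist_comm, dist_eq_norm]
      exact Real.le_sqrt_of_sq_le (hD i)
  rw [Metric.mem_closedBall, dist_comm, dist_eq_norm] at hmem
  rcases isEmpty_or_nonempty ι with hι | ⟨⟨i⟩⟩
  · simp at hsum
  · exact (Real.le_sqrt (norm_nonneg _) ((sq_nonneg _).trans (hD i))).1 hmem

/-- one-shot averaging.  If the personalization parameters are small
enough, the weighted average `x^avg` of the local minimizers is an `ε`-approximate
minimizer of the FLIX objective. -/
theorem one_shot_averaging {d n : ℕ} (hn : 0 < n)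
    (f : Fin n → EuclideanSpace ℝ (Fin d) → ℝ)
    (hdiff : ∀ i, Differentiable ℝ (f i))
    (L : Fin n → ℝ) (hsmooth : ∀ i, LSmooth (L i) (f i))
    (α : Fin n → ℝ) (hα : ∀ i, 0 ≤ α i)
    (xs : Fin n → EuclideanSpace ℝ (Fin d))
    (hxs : ∀ i y, f i (xs i) ≤ f i y)
    (ftilde : EuclideanSpace ℝ (Fin d) → ℝ)
    (hft : ftilde = fun x => (1 / n : ℝ) * ∑ i, f i (α i • x + (1 - α i) • xs i))
    (Lhat : ℝ) (hLhat : Lhat = (1 / n : ℝ) * ∑ i, L i)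
    (Lα : ℝ) (hLα : Lα = (1 / n : ℝ) * ∑ i, α i ^ 2 * L i) (hLαpos : 0 < Lα)
    (w : Fin n → ℝ) (hw : ∀ i, w i = α i ^ 2 * L i / (n * Lα))
    (xavg : EuclideanSpace ℝ (Fin d)) (hxavg : xavg = ∑ i, w i • xs i)
    (D : ℝ) (hD : D = ⨆ i, ⨆ j, ⨆ (_ : i ≠ j), ‖xs i - xs j‖ ^ 2)
    (V : ℝ) (hV : V = ∑ i, w i * ‖xs i - xavg‖ ^ 2)
    (ε : ℝ) (hε : 0 < ε)
    (hcase : (⨆ i, α i) ≤ Real.sqrt (2 * ε / (Lhat * D))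
      ∨ ∃ β : ℝ, (∀ i, α i = β) ∧ β ≤ Real.sqrt (2 * ε / (Lhat * V))) :
    ftilde xavg - ⨅ x, ftilde x ≤ ε := by
  have hn' : (0 : ℝ) < n := Nat.cast_pos.2 hn
  have : Nonempty (Fin n) := ⟨⟨0, hn⟩⟩
  rcases subsingleton_or_nontrivial (EuclideanSpace ℝ (Fin d)) with hE | hE
  · have hconst : ∀ x, ftilde x = ftilde xavg := fun x => by rw [Subsingleton.elim x xavg]
    simp only [hconst, ciInf_const, sub_self]
    exact hε.le
  have hL : ∀ i, 0 ≤ L i := fun i => (hsmooth i).nonneg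
  have hwnn : ∀ i, 0 ≤ w i := fun i => by
    rw [hw]
    have := hL i
    positivity
  have hwsum : ∑ i, w i = 1 := by
    simp only [hw]
    rw [← Finset.sum_div, div_eq_one_iff_eq (by positivity), hLα]
    field_simp
  have hLhat0 : 0 ≤ Lhat := by
    rw [hLhat]
    exact mul_nonneg (by positivity) (Finset.sum_nonneg fun i _ => hL i)
  have hV0 : 0 ≤ V := by
    rw [hV]
    exact Finset.sum_nonneg fun i _ => mul_nonneg (hwnn i) (sq_nonneg _)
  have hgap : ftilde xavg - ⨅ x, ftilde x ≤ Lα * V / 2 := by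
    have hlower : (1 / n : ℝ) * ∑ i, f i (xs i) ≤ ⨅ x, ftilde x := le_ciInf fun x => by
      rw [hft]
      exact mul_le_mul_of_nonneg_left (Finset.sum_le_sum fun i _ => hxs i _) (by positivity)
    have hupper : ftilde xavg ≤ (1 / n : ℝ) * ∑ i, f i (xs i) + Lα * V / 2 := by
      have hterm : ∀ i, f i (α i • xavg + (1 - α i) • xs i) ≤
          f i (xs i) + n * Lα / 2 * (w i * ‖xs i - xavg‖ ^ 2) := fun i => by
        have hpt : α i • xavg + (1 - α i) • xs i = xs i + α i • (xavg - xs i) := by module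
        have hdesc := (hsmooth i).sub_le_of_forall_le (hdiff i) (hxs i) (α i • (xavg - xs i))
        rw [hpt]
        refine hdesc.trans_eq ?_
        rw [norm_smul, Real.norm_of_nonneg (hα i), norm_sub_rev, hw]
        field_simp
      calc ftilde xavg
          ≤ (1 / n : ℝ) * ∑ i, (f i (xs i) + n * Lα / 2 * (w i * ‖xs i - xavg‖ ^ 2)) := by
            rw [hft]
            exact mul_le_mul_of_nonneg_left (Finset.sum_le_sum fun i _ => hterm i) (by positivity)
        _ = (1 / n : ℝ) * ∑ i, f i (xs i) + Lα * V / 2 := by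
            rw [Finset.sum_add_distrib, ← Finset.mul_sum, ← hV]
            field_simp
    linarith
  have hLα_le {a : ℝ} (ha : ∀ i, α i ≤ a) : Lα ≤ a ^ 2 * Lhat := by
    rw [hLα, hLhat, mul_left_comm, Finset.mul_sum _ _ (a ^ 2)]
    exact mul_le_mul_of_nonneg_left (Finset.sum_le_sum fun i _ =>
      mul_le_mul_of_nonneg_right (pow_le_pow_left₀ (hα i) (ha i) 2) (hL i)) (by positivity)
  obtain ⟨a, B, ha, hVB, hroot⟩ :
      ∃ a B : ℝ, (∀ i, α i ≤ a) ∧ V ≤ B ∧ a ≤ Real.sqrt (2 * ε / (Lhat * B)) := by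
    rcases hcase with hmax | ⟨β, hβ, hroot⟩
    · refine ⟨⨆ i, α i, D, le_ciSup (Set.finite_range α).bddAbove, ?_, hmax⟩
      have hdist : ∀ i j, ‖xs i - xs j‖ ^ 2 ≤ D := fun i j => by
        have hle : (⨆ (_ : i ≠ j), ‖xs i - xs j‖ ^ 2) ≤ D := by
          rw [hD]
          exact (le_ciSup (f := fun j => ⨆ (_ : i ≠ j), ‖xs i - xs j‖ ^ 2)
            (Set.finite_range _).bddAbove j).trans
            (le_ciSup (f := fun i => ⨆ j, ⨆ (_ : i ≠ j), ‖xs i - xs j‖ ^ 2)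
              (Set.finite_range _).bddAbove i)
        refine le_trans ?_ hle
        by_cases hij : i = j
        · simp [hij]
        · simp [hij]
      calc V ≤ ∑ i, w i * D := by
            rw [hV, hxavg]
            exact Finset.sum_le_sum fun i _ => mul_le_mul_of_nonneg_left
              (norm_sub_sum_smul_sq_le hwnn hwsum (hdist i)) (hwnn i)
        _ = D := by rw [← Finset.sum_mul, hwsum, one_mul]
    · exact ⟨β, V, fun i => (hβ i).le, le_rfl, hroot⟩
  have ha0 : 0 ≤ a := (hα ⟨0, hn⟩).trans (ha _)
  have hbound := Real.sq_mul_le_of_le_sqrt_div ha0 (mul_nonneg hLhat0 (hV0.trans hVB))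
    (by positivity) hroot
  have hLV : Lα * V ≤ a ^ 2 * Lhat * B :=
    mul_le_mul (hLα_le ha) hVB hV0 (mul_nonneg (sq_nonneg a) hLhat0)
  linarith
end

section
/- Let f₁,…,fₙ : ℝ^d → ℝ be differentiable with each f_i L_i-smooth and μ_i-strongly convex (μ_i > 0), let β ∈ (0,1], let x_i be the minimizer of f_i, and define f̃(x) = (1/n)∑_{i=1}^n f_i(β x + (1−β)x_i), L̂ = (1/n)∑_{i=1}^n L_i, μ̂ = (1/n)∑_{i=1}^n μ_i, w_i = L_i/∑_{j=1}^n L_j, x^avg = ∑_{i=1}^n w_i x_i, and V = ∑_{i=1}^n w_i ‖x_i − x^avg‖². Let x^0 = x^avg and x^{k+1} = x^k − (1/(β² L̂))·(β/n)∑_{i=1}^n ∇f_i(β x^k + (1−β)x_i). Then for every K ≥ 0, f̃(x^K) − min_{x∈ℝ^d} f̃(x) ≤ (1 − μ̂/L̂)^K · β² L̂ V / 2. -/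
open scoped RealInnerProductSpace

section GradientDescent

variable {d : ℕ}

theorem LSmooth.le_quadratic {L : ℝ} {g : EuclideanSpace ℝ (Fin d) → ℝ}
    (hg : Differentiable ℝ g) (hL : LSmooth L g) (x y : EuclideanSpace ℝ (Fin d)) :
    g y ≤ g x + ⟪gradient g x, y - x⟫ + L / 2 * ‖y - x‖ ^ 2 := by
  set v := y - x with hv
  let φ : ℝ → ℝ := fun t => g (x + t • v) - t * ⟪gradient g x, v⟫ - L / 2 * ‖v‖ ^ 2 * t ^ 2
  have hline : ∀ t : ℝ, HasDerivAt (fun t : ℝ => x + t • v) v t := fun t => by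
    simpa using ((hasDerivAt_id t).smul_const v).const_add x
  have hφ : ∀ t, HasDerivAt φ
      (⟪gradient g (x + t • v), v⟫ - ⟪gradient g x, v⟫ - L / 2 * ‖v‖ ^ 2 * (2 * t)) t := by
    intro t
    have h1 : HasDerivAt (fun t : ℝ => g (x + t • v)) ⟪gradient g (x + t • v), v⟫ t :=
      ((hg (x + t • v)).hasGradientAt.hasFDerivAt.comp_hasDerivAt t (hline t)).congr_deriv
        (InnerProductSpace.toDual_apply_apply)
    have h2 := (hasDerivAt_id t).mul_const ⟪gradient g x, v⟫
    have h3 := ((hasDerivAt_id t).pow 2).const_mul (L / 2 * ‖v‖ ^ 2)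
    exact ((h1.sub h2).sub h3).congr_deriv (by simp)
  have hanti : AntitoneOn φ (Set.Icc 0 1) := by
    refine antitoneOn_of_deriv_nonpos (convex_Icc 0 1)
      (fun t _ => (hφ t).continuousAt.continuousWithinAt)
      (fun t _ => (hφ t).differentiableAt.differentiableWithinAt) fun t ht => ?_
    rw [interior_Icc] at ht
    have hnorm : ‖gradient g (x + t • v) - gradient g x‖ ≤ L * (t * ‖v‖) := by
      simpa [norm_smul, abs_of_pos ht.1] using hL (x + t • v) x
    have hcs := real_inner_le_norm (gradient g (x + t • v) - gradient g x) v
    rw [inner_sub_left] at hcs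
    rw [(hφ t).deriv]
    nlinarith [mul_le_mul_of_nonneg_right hnorm (norm_nonneg v)]
  have h01 := hanti (Set.left_mem_Icc.2 zero_le_one) (Set.right_mem_Icc.2 zero_le_one) zero_le_one
  have hxv : x + v = y := by simp [hv]
  simp only [φ, one_smul, zero_smul, add_zero, hxv] at h01
  linarith

theorem StrongConvexWith.le_of_lSmooth [Nontrivial (EuclideanSpace ℝ (Fin d))] {L μ : ℝ}
    {g : EuclideanSpace ℝ (Fin d) → ℝ} (hμ : StrongConvexWith μ g) (hL : LSmooth L g) :
    μ ≤ L := by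
  obtain ⟨x, hx⟩ := exists_ne (0 : EuclideanSpace ℝ (Fin d))
  have hpos : 0 < ‖x‖ := norm_pos_iff.2 hx
  have h1 := hμ x 0
  have h2 := hμ 0 x
  have h3 := hL x 0
  have h4 := real_inner_le_norm (gradient g x - gradient g 0) x
  simp only [sub_zero, zero_sub, norm_neg, inner_neg_right] at h1 h2 h3
  rw [inner_sub_left] at h4
  have h5 := mul_le_mul_of_nonneg_right h3 hpos.le
  refine le_of_mul_le_mul_right ?_ (pow_pos hpos 2)
  nlinarith

theorem sub_le_of_gradient_step {E : Type*} [NormedAddCommGroup E] [InnerProductSpace ℝ E]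
    {F : E → ℝ} {x y v : E} {m M : ℝ} (hm : 0 < m) (hM : 0 < M)
    (hupper : F (x - (1 / M) • v) ≤
      F x + ⟪v, (x - (1 / M) • v) - x⟫ + M / 2 * ‖(x - (1 / M) • v) - x‖ ^ 2)
    (hlower : F x + ⟪v, y - x⟫ + m / 2 * ‖y - x‖ ^ 2 ≤ F y) :
    F (x - (1 / M) • v) - F y ≤ (1 - m / M) * (F x - F y) := by
  have hdescent : F (x - (1 / M) • v) ≤ F x - ‖v‖ ^ 2 / (2 * M) := by
    have hdiff : x - (1 / M) • v - x = -((1 / M) • v) := by abel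
    rw [hdiff, norm_neg, norm_smul, inner_neg_right, real_inner_smul_right,
      real_inner_self_eq_norm_sq, Real.norm_of_nonneg (by positivity)] at hupper
    refine hupper.trans_eq ?_
    field_simp
    ring
  have hcs : -(‖v‖ * ‖y - x‖) ≤ ⟪v, y - x⟫ := (abs_le.1 (abs_real_inner_le_norm v (y - x))).1
  have hPL : m * (F x - F y) ≤ ‖v‖ ^ 2 / 2 := by
    have hgap : F x - F y ≤ ‖v‖ * ‖y - x‖ - m / 2 * ‖y - x‖ ^ 2 := by linarith
    nlinarith [mul_le_mul_of_nonneg_left hgap hm.le, sq_nonneg (‖v‖ - m * ‖y - x‖)]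
  have hdiv : m / M * (F x - F y) ≤ ‖v‖ ^ 2 / (2 * M) := by
    calc m / M * (F x - F y) = m * (F x - F y) / M := by ring
      _ ≤ ‖v‖ ^ 2 / 2 / M := by gcongr
      _ = ‖v‖ ^ 2 / (2 * M) := by rw [div_div]
  linarith

end GradientDescent

/-- linear convergence of distributed gradient descent for FLIX with
equal personalization parameter `β`, initialized at the weighted average `x^avg`. -/
theorem dgd_convergence_equal_alpha {d n : ℕ} (hn : 0 < n)
    (f : Fin n → EuclideanSpace ℝ (Fin d) → ℝ)
    (hdiff : ∀ i, Differentiable ℝ (f i))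
    (L μ : Fin n → ℝ) (hμpos : ∀ i, 0 < μ i)
    (hsmooth : ∀ i, LSmooth (L i) (f i))
    (hsc : ∀ i, StrongConvexWith (μ i) (f i))
    (β : ℝ) (hβ : β ∈ Set.Ioc (0 : ℝ) 1)
    (xs : Fin n → EuclideanSpace ℝ (Fin d))
    (hxs : ∀ i y, f i (xs i) ≤ f i y)
    (ftilde : EuclideanSpace ℝ (Fin d) → ℝ)
    (hft : ftilde = fun x => (1 / n : ℝ) * ∑ i, f i (β • x + (1 - β) • xs i))
    (Lhat : ℝ) (hLhat : Lhat = (1 / n : ℝ) * ∑ i, L i)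
    (μhat : ℝ) (hμhat : μhat = (1 / n : ℝ) * ∑ i, μ i)
    (w : Fin n → ℝ) (hw : ∀ i, w i = L i / ∑ j, L j)
    (xavg : EuclideanSpace ℝ (Fin d)) (hxavg : xavg = ∑ i, w i • xs i)
    (V : ℝ) (hV : V = ∑ i, w i * ‖xs i - xavg‖ ^ 2)
    (x : ℕ → EuclideanSpace ℝ (Fin d)) (hx0 : x 0 = xavg)
    (hstep : ∀ k, x (k + 1) = x k
      - ((1 / (β ^ 2 * Lhat)) * (β / n : ℝ)) •
          ∑ i, gradient (f i) (β • x k + (1 - β) • xs i))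
    (K : ℕ) :
    ftilde (x K) - ⨅ y, ftilde y ≤ (1 - μhat / Lhat) ^ K * (β ^ 2 * Lhat * V / 2) := by
  obtain ⟨hβ0, hβ1⟩ := hβ
  have hn' : (0 : ℝ) < n := Nat.cast_pos.2 hn
  have : Nonempty (Fin n) := ⟨⟨0, hn⟩⟩
  rcases subsingleton_or_nontrivial (EuclideanSpace ℝ (Fin d)) with hsub | hnt
  · have hinf : ⨅ y, ftilde y = ftilde (x K) := by
      rw [show ftilde = fun _ => ftilde (x K) from
        funext fun y => congrArg ftilde (Subsingleton.elim _ _), ciInf_const]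
    have hV0 : V = 0 := by
      rw [hV]
      exact Finset.sum_eq_zero fun i _ => by simp [Subsingleton.elim (xs i) xavg]
    simp [hinf, hV0]
  have hμL : ∀ i, μ i ≤ L i := fun i => (hsc i).le_of_lSmooth (hsmooth i)
  have hLsum : 0 < ∑ i, L i :=
    Finset.sum_pos (fun i _ => (hμpos i).trans_le (hμL i)) Finset.univ_nonempty
  have hLhat0 : 0 < Lhat := by rw [hLhat]; positivity
  have hμhat0 : 0 < μhat := by
    rw [hμhat]
    exact mul_pos (by positivity) (Finset.sum_pos (fun i _ => hμpos i) Finset.univ_nonempty)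
  have hμLhat : μhat ≤ Lhat := by
    rw [hμhat, hLhat]
    gcongr with i
    exact hμL i
  set G : EuclideanSpace ℝ (Fin d) → EuclideanSpace ℝ (Fin d) := fun z =>
    (β / n : ℝ) • ∑ i, gradient (f i) (β • z + (1 - β) • xs i) with hG
  have hexpand : ∀ (c : Fin n → ℝ) (z y : EuclideanSpace ℝ (Fin d)),
      (1 / n : ℝ) * ∑ i, (f i (β • z + (1 - β) • xs i)
        + ⟪gradient (f i) (β • z + (1 - β) • xs i),
            (β • y + (1 - β) • xs i) - (β • z + (1 - β) • xs i)⟫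
        + c i / 2 * ‖(β • y + (1 - β) • xs i) - (β • z + (1 - β) • xs i)‖ ^ 2)
      = ftilde z + ⟪G z, y - z⟫ + β ^ 2 * ((1 / n : ℝ) * ∑ i, c i) / 2 * ‖y - z‖ ^ 2 := by
    intro c z y
    have hsub : ∀ i, (β • y + (1 - β) • xs i) - (β • z + (1 - β) • xs i) = β • (y - z) := by
      intro i
      rw [add_sub_add_right_eq_sub, smul_sub]
    simp only [hsub, Finset.sum_add_distrib, real_inner_smul_right, real_inner_smul_left,
      norm_smul, hft, hG, sum_inner, ← Finset.mul_sum, ← Finset.sum_mul, ← Finset.sum_div,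
      mul_pow, Real.norm_eq_abs, sq_abs]
    ring
  have hupper : ∀ z y, ftilde y ≤
      ftilde z + ⟪G z, y - z⟫ + β ^ 2 * Lhat / 2 * ‖y - z‖ ^ 2 := by
    intro z y
    rw [hLhat, ← hexpand L z y]
    simp only [hft]
    gcongr with i
    exact (hsmooth i).le_quadratic (hdiff i) _ _
  have hlower : ∀ z y,
      ftilde z + ⟪G z, y - z⟫ + β ^ 2 * μhat / 2 * ‖y - z‖ ^ 2 ≤ ftilde y := by
    intro z y
    rw [hμhat, ← hexpand μ z y]
    simp only [hft]
    gcongr with i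
    exact hsc i _ _
  have hbound : ∀ y, (1 / n : ℝ) * ∑ i, f i (xs i) ≤ ftilde y := by
    intro y
    simp only [hft]
    gcongr with i
    exact hxs i _
  have hgrad : ∀ i, gradient (f i) (xs i) = 0 := by
    intro i
    have hmin : IsLocalMin (f i) (xs i) := Filter.Eventually.of_forall (hxs i)
    simp [gradient, hmin.fderiv_eq_zero]
  have hstart : ftilde (x 0) ≤ (1 / n : ℝ) * ∑ i, f i (xs i) + β ^ 2 * Lhat * V / 2 := by
    have hcomp : ∀ i, f i (β • xavg + (1 - β) • xs i) ≤
        f i (xs i) + L i * ‖xs i - xavg‖ ^ 2 * (β ^ 2 / 2) := by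
      intro i
      have h := (hsmooth i).le_quadratic (hdiff i) (xs i) (β • xavg + (1 - β) • xs i)
      have hdisp : β • xavg + (1 - β) • xs i - xs i = β • (xavg - xs i) := by module
      rw [hgrad, inner_zero_left, hdisp, norm_smul, norm_sub_rev, mul_pow, Real.norm_eq_abs,
        sq_abs] at h
      linarith
    have hLV : Lhat * V = (1 / n : ℝ) * ∑ i, L i * ‖xs i - xavg‖ ^ 2 := by
      rw [hLhat, hV, mul_assoc, Finset.mul_sum]
      congr 1
      refine Finset.sum_congr rfl fun i _ => ?_
      rw [hw]
      field_simp
    calc ftilde (x 0) = (1 / n : ℝ) * ∑ i, f i (β • xavg + (1 - β) • xs i) := by rw [hft, hx0]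
      _ ≤ (1 / n : ℝ) * ∑ i, (f i (xs i) + L i * ‖xs i - xavg‖ ^ 2 * (β ^ 2 / 2)) := by
        gcongr with i
        exact hcomp i
      _ = (1 / n : ℝ) * ∑ i, f i (xs i) + Lhat * V * (β ^ 2 / 2) := by
        rw [hLV, Finset.sum_add_distrib, ← Finset.sum_mul]
        ring
      _ = _ := by ring
  have hrate : 0 ≤ 1 - μhat / Lhat := sub_nonneg.2 ((div_le_one hLhat0).2 hμLhat)
  have hcontract : ∀ k y,
      ftilde (x (k + 1)) - ftilde y ≤ (1 - μhat / Lhat) * (ftilde (x k) - ftilde y) := by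
    intro k y
    have hxk : x (k + 1) = x k - (1 / (β ^ 2 * Lhat)) • G (x k) := by
      rw [hstep k, mul_smul]
    have h := sub_le_of_gradient_step (m := β ^ 2 * μhat) (M := β ^ 2 * Lhat)
      (by positivity) (by positivity) (hupper (x k) _) (hlower (x k) y)
    rwa [mul_div_mul_left _ _ (by positivity), ← hxk] at h
  have hpow : ∀ k y,
      ftilde (x k) - ftilde y ≤ (1 - μhat / Lhat) ^ k * (ftilde (x 0) - ftilde y) := by
    intro k y
    induction k with
    | zero => simp
    | succ k ih =>
      calc _ ≤ _ := hcontract k y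
        _ ≤ _ := mul_le_mul_of_nonneg_left ih hrate
        _ = _ := by ring
  have hmain : ∀ y,
      ftilde (x K) - (1 - μhat / Lhat) ^ K * (β ^ 2 * Lhat * V / 2) ≤ ftilde y := by
    intro y
    have hgap : ftilde (x 0) - ftilde y ≤ β ^ 2 * Lhat * V / 2 := by linarith [hbound y]
    linarith [hpow K y, mul_le_mul_of_nonneg_left hgap (pow_nonneg hrate K)]
  linarith [le_ciInf hmain]
end
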